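/- Assume the time-varying graph G[A(·)] is cut-balanced. Then for any solution x of ẋ(t) = −L[A(t)]x(t), with χ_i(t) = |x_i(t)| and θ_{ij}(t) = sgn(a_{ij}(t))sgn(x_i(t))sgn(x_j(t)): (1) the functions η_{ij}(t) = |a_{ij}(t)|(θ_{ij}(t)χ_j(t) − χ_i(t)) and the derivatives χ̇_i belong to L¹[0,∞); (2) the finite limits x_i⁰ = lim_{t→∞} x_i(t) exist for every i; (3) if ∫_0^∞|a_{ij}(t)|dt = ∞ then |x_i⁰| = |x_j⁰|; moreover x_i⁰ = x_j⁰ if ∫_0^∞ a_{ij}⁺(t)dt = ∞ (essential cooperation), x_i⁰ = −x_j⁰ if ∫_0^∞ a_{ij}⁻(t)dt = ∞ (essential competition), and x_i⁰ = x_j⁰ = 0 if both integrals are infinite. -/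

import Mathlib

open MeasureTheory Filter Matrix Finset Topology

/-- The signed Laplacian `L[A]` of a signed adjacency matrix:
off-diagonal entries `L j k = -A j k`, diagonal entries `L j j = ∑ m, |A j m|`. -/
noncomputable def sLap {N : ℕ} (A : Matrix (Fin N) (Fin N) ℝ) : Matrix (Fin N) (Fin N) ℝ :=
  fun j k => if j = k then ∑ m, |A j m| else -A j k

/-- A time-varying signed adjacency matrix: entrywise measurable, locally bounded,
with zero diagonal. -/
def IsAdjacency {N : ℕ} (A : ℝ → Matrix (Fin N) (Fin N) ℝ) : Prop :=
  (∀ j k, Measurable fun t => A t j k) ∧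
  (∀ T : ℝ, ∃ C : ℝ, ∀ t ∈ Set.Icc (0:ℝ) T, ∀ j k, |A t j k| ≤ C) ∧
  (∀ t j, A t j j = 0)

/-- A solution of `ẋ = −L[A(t)]x` on `[0,∞)`: continuous and satisfying the integral
equation (equivalently, locally absolutely continuous and satisfying the ODE a.e.). -/
def IsSolution {N : ℕ} (A : ℝ → Matrix (Fin N) (Fin N) ℝ) (x : ℝ → Fin N → ℝ) : Prop :=
  ContinuousOn x (Set.Ici 0) ∧
  ∀ t ∈ Set.Ici (0:ℝ), ∀ j,
    x t j = x 0 j + ∫ s in (0:ℝ)..t, -((sLap (A s)).mulVec (x s) j)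

/-- Quasi-strong connectivity of the static signed graph `G[A]`: some root reaches
every node along arcs `k → j` present whenever `A j k ≠ 0`. -/
def QSC {N : ℕ} (A : Matrix (Fin N) (Fin N) ℝ) : Prop :=
  ∃ r : Fin N, ∀ j : Fin N, Relation.ReflTransGen (fun k j => A j k ≠ 0) r j

/-- Structural balance of the static signed graph `G[A]`: the nodes split into the camp `S`
and its complement (one possibly empty), with nonnegative weights inside a camp and
nonpositive weights between camps. -/
def StructBal {N : ℕ} (A : Matrix (Fin N) (Fin N) ℝ) : Prop :=
  ∃ S : Set (Fin N), ∀ j k : Fin N,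
    ((j ∈ S ↔ k ∈ S) → 0 ≤ A j k) ∧ (¬(j ∈ S ↔ k ∈ S) → A j k ≤ 0)

/-- `∫_0^∞ |a_{jk}(t)| dt = ∞`: arc `k → j` of the graph of essential interactions. -/
def EssArc {N : ℕ} (A : ℝ → Matrix (Fin N) (Fin N) ℝ) (j k : Fin N) : Prop :=
  ∫⁻ t in Set.Ici (0:ℝ), ENNReal.ofReal |A t j k| = ⊤

/-- `∫_0^∞ a_{jk}⁺(t) dt = ∞`: agents `j` and `k` essentially cooperate. -/
def EssPlus {N : ℕ} (A : ℝ → Matrix (Fin N) (Fin N) ℝ) (j k : Fin N) : Prop :=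
  ∫⁻ t in Set.Ici (0:ℝ), ENNReal.ofReal (max (A t j k) 0) = ⊤

/-- `∫_0^∞ a_{jk}⁻(t) dt = ∞`: agents `j` and `k` essentially compete. -/
def EssMinus {N : ℕ} (A : ℝ → Matrix (Fin N) (Fin N) ℝ) (j k : Fin N) : Prop :=
  ∫⁻ t in Set.Ici (0:ℝ), ENNReal.ofReal (max (-(A t j k)) 0) = ⊤

/-- Reachability from `u` to `v` in the graph of essential interactions. -/
def EssReach {N : ℕ} (A : ℝ → Matrix (Fin N) (Fin N) ℝ) (u v : Fin N) : Prop :=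
  Relation.ReflTransGen (fun k j => EssArc A j k) u v

/-- Uniform strong connectivity of the time-varying graph `G[A(·)]`. -/
def USC {N : ℕ} (A : ℝ → Matrix (Fin N) (Fin N) ℝ) : Prop :=
  ∃ T > (0:ℝ), ∃ ε > (0:ℝ), ∀ t ≥ (0:ℝ), ∀ u v : Fin N,
    Relation.ReflTransGen (fun k j => ε ≤ ∫ s in t..(t + T), |A s j k|) u v

/-- Uniform quasi-strong connectivity of the time-varying graph `G[A(·)]`. -/
def UQSC {N : ℕ} (A : ℝ → Matrix (Fin N) (Fin N) ℝ) : Prop :=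
  ∃ T > (0:ℝ), ∃ ε > (0:ℝ), ∀ t ≥ (0:ℝ), ∃ r : Fin N, ∀ j : Fin N,
    Relation.ReflTransGen (fun k j => ε ≤ ∫ s in t..(t + T), |A s j k|) r j

/-- Cut-balance of the time-varying graph `G[A(·)]` with some constant `K ≥ 1`. -/
def CutBalanced {N : ℕ} (A : ℝ → Matrix (Fin N) (Fin N) ℝ) : Prop :=
  ∃ K : ℝ, 1 ≤ K ∧ ∀ᵐ t ∂(volume.restrict (Set.Ici (0:ℝ))),
    ∀ V : Finset (Fin N), V.Nonempty → V ≠ Finset.univ →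
      K⁻¹ * (∑ j ∈ V, ∑ k ∈ Vᶜ, |A t k j|) ≤ (∑ j ∈ V, ∑ k ∈ Vᶜ, |A t j k|) ∧
      (∑ j ∈ V, ∑ k ∈ Vᶜ, |A t j k|) ≤ K * (∑ j ∈ V, ∑ k ∈ Vᶜ, |A t k j|)

/-- The protocol establishes modulus consensus: the moduli of all opinions converge
to a common limit for every solution. -/
def ModulusConsensus {N : ℕ} (A : ℝ → Matrix (Fin N) (Fin N) ℝ) : Prop :=
  ∀ x : ℝ → Fin N → ℝ, IsSolution A x →
    ∃ c : ℝ, 0 ≤ c ∧ ∀ i, Tendsto (fun t => |x t i|) atTop (𝓝 c)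

/-- The protocol establishes bipartite consensus: there are `v ≠ 0` and `ρ ∈ {±1}^N` such that
every solution converges to `ρ (vᵀ x(0))`. -/
def BipartiteConsensus {N : ℕ} (A : ℝ → Matrix (Fin N) (Fin N) ℝ) : Prop :=
  ∃ v ρ : Fin N → ℝ, v ≠ 0 ∧ (∀ i, ρ i = 1 ∨ ρ i = -1) ∧
    ∀ x : ℝ → Fin N → ℝ, IsSolution A x →
      ∀ i, Tendsto (fun t => x t i) atTop (𝓝 (ρ i * ∑ j, v j * x 0 j))

/-- The essential-interaction signed graph `𝒢^±` is structurally balanced: the camp `S` and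
its complement contain all essentially-cooperating pairs inside a camp and all
essentially-competing pairs between the camps. -/
def EssStructBal {N : ℕ} (A : ℝ → Matrix (Fin N) (Fin N) ℝ) : Prop :=
  ∃ S : Set (Fin N),
    (∀ j k, EssPlus A j k → (j ∈ S ↔ k ∈ S)) ∧
    (∀ j k, EssMinus A j k → ¬(j ∈ S ↔ k ∈ S))

lemma sum_indicator_dissipation {ι : Type*} [Fintype ι] [DecidableEq ι] {w : ι → ι → ℝ}
    (hw : ∀ i j, 0 ≤ w i j) {K b c : ℝ} (hK : 1 ≤ K) (V : Finset ι) {q : ι → ℝ}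
    (hc : 0 ≤ c) (hcb : c * (2 * (1 + K)) ≤ b)
    (hin : ∀ i ∈ V, b ≤ q i) (hout : ∀ i ∉ V, q i * (2 * K) ≤ b)
    (hcut : ∑ j ∈ V, ∑ k ∈ Vᶜ, w k j ≤ K * ∑ j ∈ V, ∑ k ∈ Vᶜ, w j k) :
    ∑ i, ∑ j, (q i * (w i j * ((if j ∈ V then 1 else 0) - (if i ∈ V then 1 else 0)))
      + c * (w i j * |(if j ∈ V then (1 : ℝ) else 0) - (if i ∈ V then 1 else 0)|)) ≤ 0 := by
  have hK0 : 0 < 2 * K := by linarith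
  have hsum : ∀ (U W : Finset ι) (f : ι → ι → ℝ), ∑ j ∈ U, ∑ k ∈ W, f j k
      = ∑ i, ∑ j, if i ∈ U ∧ j ∈ W then f i j else 0 := by
    intro U W f
    have : ∀ i, (∑ j, if i ∈ U ∧ j ∈ W then f i j else 0)
        = if i ∈ U then ∑ j ∈ W, f i j else 0 := fun i => by
      by_cases hi : i ∈ U <;> simp [hi]
    simp [this]
  have houtgoing := hsum V Vᶜ w
  have hincoming := (hsum V Vᶜ fun j k => w k j).trans Finset.sum_comm
  have hterm : ∀ i j, q i * (w i j * ((if j ∈ V then 1 else 0) - (if i ∈ V then 1 else 0)))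
      + c * (w i j * |(if j ∈ V then (1 : ℝ) else 0) - (if i ∈ V then 1 else 0)|)
      ≤ (c - b) * (if i ∈ V ∧ j ∈ Vᶜ then w i j else 0)
        + (b / (2 * K) + c) * (if j ∈ V ∧ i ∈ Vᶜ then w i j else 0) := by
    intro i j
    by_cases hi : i ∈ V <;> by_cases hj : j ∈ V <;> simp [hi, hj]
    · nlinarith [mul_le_mul_of_nonneg_right (hin i hi) (hw i j)]
    · have := mul_le_mul_of_nonneg_right ((le_div_iff₀ hK0).2 (hout i hi)) (hw i j)
      linarith
  have hO : 0 ≤ ∑ j ∈ V, ∑ k ∈ Vᶜ, w j k :=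
    Finset.sum_nonneg fun _ _ => Finset.sum_nonneg fun _ _ => hw _ _
  have hb : 0 ≤ b := by nlinarith
  calc _ ≤ _ := Finset.sum_le_sum fun i _ => Finset.sum_le_sum fun j _ => hterm i j
    _ = (c - b) * (∑ j ∈ V, ∑ k ∈ Vᶜ, w j k)
        + (b / (2 * K) + c) * (∑ j ∈ V, ∑ k ∈ Vᶜ, w k j) := by
      rw [houtgoing, hincoming]
      simp only [Finset.mul_sum, Finset.sum_add_distrib]
    _ ≤ (c - b) * (∑ j ∈ V, ∑ k ∈ Vᶜ, w j k)
        + (b / (2 * K) + c) * (K * ∑ j ∈ V, ∑ k ∈ Vᶜ, w j k) := by gcongr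
    _ = (c * (2 * (1 + K)) - b) / 2 * (∑ j ∈ V, ∑ k ∈ Vᶜ, w j k) := by
      field_simp; ring
    _ ≤ 0 := mul_nonpos_of_nonpos_of_nonneg (by linarith) hO

/-- Layer-cake decomposition of a nonnegative vector along a sorting permutation. -/
lemma exists_layers {N : ℕ} {y : Fin N → ℝ} (hy : ∀ i, 0 ≤ y i) (σ : Equiv.Perm (Fin N))
    (hσ : ∀ i j, σ i ≤ σ j → y j ≤ y i) :
    ∃ g : Fin N → ℝ, (∀ m, 0 ≤ g m) ∧ ∀ i, y i = ∑ m, g m * (if σ i ≤ m then 1 else 0) := by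
  let Y : ℕ → ℝ := fun n => if h : n < N then y (σ.symm ⟨n, h⟩) else 0
  have hY : ∀ i, y i = Y (σ i) := fun i => by simp [Y]
  have hYN : Y N = 0 := by simp [Y]
  refine ⟨fun m => Y m - Y (m + 1), fun m => ?_, fun i => ?_⟩
  · have h0 : Y m = y (σ.symm m) := by simp [Y]
    by_cases h : (m : ℕ) + 1 < N
    · have h1 : Y (m + 1) = y (σ.symm ⟨m + 1, h⟩) := by simp [Y, h]
      change 0 ≤ Y m - Y (m + 1)
      rw [h0, h1, sub_nonneg]
      apply hσ
      simp [Fin.le_def]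
    · have h1 : Y (m + 1) = 0 := by simp [Y, h]
      change 0 ≤ Y m - Y (m + 1)
      rw [h0, h1, sub_zero]
      exact hy _
  · have htel : ∀ n ≤ N, ∀ k ≤ n,
        ∑ m ∈ Finset.range n, (Y m - Y (m + 1)) * (if k ≤ m then 1 else 0) = Y k - Y n := by
      intro n hn
      induction n with
      | zero => intro k hk; simp [Nat.le_zero.1 hk]
      | succ n ih =>
        intro k hk
        rw [Finset.sum_range_succ]
        rcases Nat.lt_or_ge n k with h | h
        · obtain rfl : k = n + 1 := by omega
          rw [Finset.sum_eq_zero]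
          · simp
          · intro m hm
            have := Finset.mem_range.1 hm
            rw [if_neg (by omega), mul_zero]
        · rw [ih (by omega) k h, if_pos h]
          ring
    have := htel N le_rfl (σ i) (σ i).2.le
    rw [hYN, sub_zero, ← hY, Finset.sum_range] at this
    rw [← this]
    simp only [Fin.le_def]

lemma weighted_dissipation {N : ℕ} {w : Fin N → Fin N → ℝ} (hw : ∀ i j, 0 ≤ w i j)
    {K c : ℝ} (hK : 1 ≤ K)
    (hcut : ∀ V : Finset (Fin N), V.Nonempty → V ≠ univ →
      ∑ j ∈ V, ∑ k ∈ Vᶜ, w k j ≤ K * ∑ j ∈ V, ∑ k ∈ Vᶜ, w j k)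
    (hc : 0 ≤ c) {p : Fin N → ℝ} (hcp : ∀ m, c * (2 * (1 + K)) ≤ p m) (hp : Antitone p)
    (hp2 : ∀ m n, m < n → p n * (2 * K) ≤ p m)
    {y : Fin N → ℝ} (hy : ∀ i, 0 ≤ y i) (σ : Equiv.Perm (Fin N))
    (hσ : ∀ i j, σ i ≤ σ j → y j ≤ y i) :
    ∑ i, ∑ j, (p (σ i) * (w i j * (y j - y i)) + c * (w i j * |y j - y i|)) ≤ 0 := by
  obtain ⟨g, hg, hyg⟩ := exists_layers hy σ hσ
  let V : Fin N → Finset (Fin N) := fun m => univ.filter (σ · ≤ m)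
  let e : Fin N → Fin N → ℝ := fun m i => if i ∈ V m then 1 else 0
  have hye : ∀ i, y i = ∑ m, g m * e m i := fun i => by simpa [e, V] using hyg i
  have hdiff : ∀ i j, y j - y i = ∑ m, g m * (e m j - e m i) := fun i j => by
    rw [hye i, hye j, ← Finset.sum_sub_distrib]
    simp only [mul_sub]
  have habs : ∀ i j, |y j - y i| ≤ ∑ m, g m * |e m j - e m i| := fun i j => by
    rw [hdiff]
    refine (Finset.abs_sum_le_sum_abs _ _).trans_eq ?_
    simp only [abs_mul, abs_of_nonneg (hg _)]
  have hterm : ∀ i j, p (σ i) * (w i j * (y j - y i)) + c * (w i j * |y j - y i|) ≤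
      ∑ m, g m * (p (σ i) * (w i j * (e m j - e m i)) + c * (w i j * |e m j - e m i|)) := by
    intro i j
    have h1 := mul_le_mul_of_nonneg_left
      (mul_le_mul_of_nonneg_left (habs i j) (hw i j)) hc
    rw [hdiff i j] at h1 ⊢
    refine (add_le_add_right h1 _).trans_eq ?_
    simp only [Finset.mul_sum, ← Finset.sum_add_distrib]
    exact Finset.sum_congr rfl fun m _ => by ring
  calc _ ≤ _ := Finset.sum_le_sum fun i _ => Finset.sum_le_sum fun j _ => hterm i j
    _ = ∑ m, g m * ∑ i, ∑ j,
        (p (σ i) * (w i j * (e m j - e m i)) + c * (w i j * |e m j - e m i|)) := by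
      simp only [Finset.mul_sum]
      rw [Finset.sum_comm]
      refine (Finset.sum_congr rfl fun j _ => Finset.sum_comm).trans ?_
      rw [Finset.sum_comm]
      exact Finset.sum_congr rfl fun m _ => Finset.sum_comm
    _ ≤ 0 := Finset.sum_nonpos fun m _ => mul_nonpos_of_nonneg_of_nonpos (hg m) ?_
  refine sum_indicator_dissipation hw hK (V m) hc (hcp m) (fun i hi => hp ?_)
    (fun i hi => hp2 _ _ ?_) ?_
  · simpa [V] using hi
  · simpa [V] using hi
  · by_cases hV : V m = univ
    · simp [hV]
    · exact hcut _ ⟨σ.symm m, by simp [V]⟩ hV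

/-- The maximum over all pairings of the weights `p` with the entries of `y`; for antitone `p`
it is attained by sorting `y` decreasingly. -/
noncomputable def sortedPotential {N : ℕ} (p y : Fin N → ℝ) : ℝ :=
  (univ : Finset (Equiv.Perm (Fin N))).sup' ⟨1, mem_univ _⟩ fun σ => ∑ i, p (σ i) * y i

lemma le_sortedPotential {N : ℕ} (p y : Fin N → ℝ) (σ : Equiv.Perm (Fin N)) :
    ∑ i, p (σ i) * y i ≤ sortedPotential p y :=
  Finset.le_sup' (fun σ : Equiv.Perm (Fin N) => ∑ i, p (σ i) * y i) (mem_univ σ)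

lemma sortedPotential_eq {N : ℕ} {p y : Fin N → ℝ} (hp : Antitone p) {σ : Equiv.Perm (Fin N)}
    (hσ : ∀ i j, σ i ≤ σ j → y j ≤ y i) : sortedPotential p y = ∑ i, p (σ i) * y i := by
  refine le_antisymm (Finset.sup'_le _ _ fun τ _ => ?_) (le_sortedPotential p y σ)
  have hmono : Monovary (p ∘ σ) y := fun i j hij => hp <| by
    by_contra! h
    exact hij.not_ge (hσ i j h.le)
  simpa using hmono.sum_comp_perm_mul_le_sum_mul (σ := τ.trans σ.symm)

lemma sortedPotential_nonneg {N : ℕ} {p y : Fin N → ℝ} (hp : ∀ i, 0 ≤ p i) (hy : ∀ i, 0 ≤ y i) :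
    0 ≤ sortedPotential p y :=
  (Finset.sum_nonneg fun i _ => mul_nonneg (hp _) (hy i)).trans (le_sortedPotential p y 1)

lemma sortedPotential_le_add {N : ℕ} {p y z : Fin N → ℝ} {δ : ℝ} (hp : ∀ i, 0 ≤ p i)
    (h : ∀ i, |y i - z i| ≤ δ) :
    sortedPotential p y ≤ sortedPotential p z + (∑ i, p i) * δ := by
  refine Finset.sup'_le _ _ fun σ _ => ?_
  calc ∑ i, p (σ i) * y i ≤ ∑ i, (p (σ i) * z i + p (σ i) * δ) :=
        Finset.sum_le_sum fun i _ => by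
          nlinarith [mul_le_mul_of_nonneg_left ((abs_le.1 (h i)).2) (hp (σ i))]
    _ = ∑ i, p (σ i) * z i + (∑ i, p i) * δ := by
        rw [Finset.sum_add_distrib, ← Finset.sum_mul, Equiv.sum_comp σ p]
    _ ≤ _ := by gcongr; exact le_sortedPotential p z σ

lemma exists_sorting_perm {N : ℕ} (y : Fin N → ℝ) :
    ∃ σ : Equiv.Perm (Fin N), ∀ i j, σ i ≤ σ j → y j ≤ y i := by
  refine ⟨(Tuple.sort fun i => -y i).symm, fun i j hij => ?_⟩
  simpa using Tuple.monotone_sort (fun i => -y i) hij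

/-- The contribution of agent `j` to the velocity of agent `i`. -/
noncomputable def flux {N : ℕ} (A : Matrix (Fin N) (Fin N) ℝ) (y : Fin N → ℝ) (i j : Fin N) : ℝ :=
  A i j * y j - |A i j| * y i

lemma neg_sLap_mulVec {N : ℕ} {A : Matrix (Fin N) (Fin N) ℝ} (hA : ∀ j, A j j = 0)
    (y : Fin N → ℝ) (i : Fin N) : -((sLap A).mulVec y i) = ∑ j, flux A y i j := by
  have h : ∀ j, sLap A i j * y j = (if i = j then (∑ m, |A i m|) * y i else 0) - A i j * y j := by
    intro j
    by_cases hij : i = j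
    · subst hij; simp [sLap, hA]
    · simp [sLap, hij]
  simp only [Matrix.mulVec, dotProduct, h, flux, Finset.sum_sub_distrib, Finset.sum_mul]
  simp

lemma realSign_mul_self (r : ℝ) : Real.sign r * r = |r| := by
  rcases lt_trichotomy r 0 with h | rfl | h
  · simp [Real.sign_of_neg h, abs_of_neg h]
  · simp
  · simp [Real.sign_of_pos h, abs_of_pos h]

lemma abs_mul_sign_eq (a u v : ℝ) :
    |a| * ((Real.sign a * Real.sign u * Real.sign v) * |v| - |u|)
      = Real.sign u * (a * v - |a| * u) := by
  have h : ∀ r : ℝ, Real.sign r * |r| = r := fun r => by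
    rcases lt_trichotomy r 0 with h | rfl | h
    · simp [Real.sign_of_neg h, abs_of_neg h]
    · simp
    · simp [Real.sign_of_pos h, abs_of_pos h]
  calc _ = Real.sign u * ((Real.sign a * |a|) * (Real.sign v * |v|)) - |a| * |u| := by ring
    _ = _ := by rw [h, h, ← realSign_mul_self u]; ring

/-- The total dissipation: moduli differences together with the slack in the differential
inequality satisfied by the moduli. -/
noncomputable def dissipation {N : ℕ} (A : Matrix (Fin N) (Fin N) ℝ) (y : Fin N → ℝ) : ℝ :=
  ∑ i, ∑ j, (|A i j| * |(|y j| - |y i|)| + (|A i j| * |y j| - Real.sign (y i) * (A i j * y j)))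

lemma sign_mul_le_abs (u r : ℝ) : Real.sign u * r ≤ |r| := by
  rcases Real.sign_apply_eq u with h | h | h <;> rw [h]
  · linarith [neg_le_abs r]
  · simp
  · linarith [le_abs_self r]

lemma dissipation_slack_nonneg (a u v : ℝ) : 0 ≤ |a| * |v| - Real.sign u * (a * v) := by
  have := sign_mul_le_abs u (a * v)
  rw [abs_mul] at this
  linarith

lemma le_dissipation {N : ℕ} (A : Matrix (Fin N) (Fin N) ℝ) (y : Fin N → ℝ) (i j : Fin N) :
    |A i j| * |(|y j| - |y i|)| + (|A i j| * |y j| - Real.sign (y i) * (A i j * y j))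
      ≤ dissipation A y := by
  have h0 : ∀ i j, 0 ≤ |A i j| * |(|y j| - |y i|)|
      + (|A i j| * |y j| - Real.sign (y i) * (A i j * y j)) := fun i j =>
    add_nonneg (by positivity) (dissipation_slack_nonneg _ _ _)
  calc _ ≤ _ := Finset.single_le_sum (f := fun j => |A i j| * |(|y j| - |y i|)|
          + (|A i j| * |y j| - Real.sign (y i) * (A i j * y j))) (fun j _ => h0 i j) (mem_univ j)
    _ ≤ _ := Finset.single_le_sum (f := fun i => ∑ j, (|A i j| * |(|y j| - |y i|)|
          + (|A i j| * |y j| - Real.sign (y i) * (A i j * y j))))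
          (fun i _ => Finset.sum_nonneg fun j _ => h0 i j) (mem_univ i)

lemma sign_mul_flux {N : ℕ} (A : Matrix (Fin N) (Fin N) ℝ) (y : Fin N → ℝ) (i j : Fin N) :
    Real.sign (y i) * flux A y i j = |A i j| * (|y j| - |y i|)
      - (|A i j| * |y j| - Real.sign (y i) * (A i j * y j)) := by
  rw [flux, ← realSign_mul_self (y i)]
  ring

lemma mul_abs_sub_le_dissipation {N : ℕ} (A : Matrix (Fin N) (Fin N) ℝ) (y : Fin N → ℝ)
    (i j : Fin N) : |A i j| * |(|y i| - |y j|)| ≤ dissipation A y := by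
  rw [abs_sub_comm]
  linarith [le_dissipation A y i j, dissipation_slack_nonneg (A i j) (y i) (y j)]

lemma abs_sign_mul_flux_le {N : ℕ} (A : Matrix (Fin N) (Fin N) ℝ) (y : Fin N → ℝ)
    (i j : Fin N) : |Real.sign (y i) * flux A y i j| ≤ dissipation A y := by
  rw [sign_mul_flux]
  refine (abs_sub _ _).trans ?_
  rw [abs_mul, abs_abs, abs_of_nonneg (dissipation_slack_nonneg _ _ _)]
  exact le_dissipation A y i j

lemma abs_flux_le {N : ℕ} (A : Matrix (Fin N) (Fin N) ℝ) (y : Fin N → ℝ)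
    (i j : Fin N) : |flux A y i j| ≤ dissipation A y := by
  by_cases h : y i = 0
  · have := mul_abs_sub_le_dissipation A y i j
    simpa [flux, h, abs_mul] using this
  · have := abs_sign_mul_flux_le A y i j
    have hs : |Real.sign (y i)| = 1 := by
      rcases Real.sign_apply_eq_of_ne_zero _ h with h | h <;> simp [h]
    rwa [abs_mul, hs, one_mul] at this

lemma dissipation_nonneg {N : ℕ} (A : Matrix (Fin N) (Fin N) ℝ) (y : Fin N → ℝ) :
    0 ≤ dissipation A y :=
  Finset.sum_nonneg fun _ _ => Finset.sum_nonneg fun _ _ =>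
    add_nonneg (by positivity) (dissipation_slack_nonneg _ _ _)

lemma mul_dissipation_le {N : ℕ} {A : Matrix (Fin N) (Fin N) ℝ}
    {K c : ℝ} (hK : 1 ≤ K)
    (hcut : ∀ V : Finset (Fin N), V.Nonempty → V ≠ univ →
      ∑ j ∈ V, ∑ k ∈ Vᶜ, |A k j| ≤ K * ∑ j ∈ V, ∑ k ∈ Vᶜ, |A j k|)
    (hc : 0 ≤ c) {p : Fin N → ℝ} (hcp : ∀ m, c * (2 * (1 + K)) ≤ p m) (hp : Antitone p)
    (hp2 : ∀ m n, m < n → p n * (2 * K) ≤ p m)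
    (y : Fin N → ℝ) (σ : Equiv.Perm (Fin N)) (hσ : ∀ i j, σ i ≤ σ j → |y j| ≤ |y i|) :
    c * dissipation A y ≤ -∑ i, p (σ i) * (Real.sign (y i) * ∑ j, flux A y i j) := by
  have key := weighted_dissipation (w := fun i j => |A i j|) (fun i j => abs_nonneg _) hK hcut hc
    hcp hp hp2 (fun i => abs_nonneg (y i)) σ hσ
  rw [dissipation, ← sub_nonpos, sub_neg_eq_add]
  refine le_trans ?_ key
  simp only [Finset.mul_sum, ← Finset.sum_add_distrib]
  refine Finset.sum_le_sum fun i _ => Finset.sum_le_sum fun j _ => ?_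
  rw [sign_mul_flux]
  have hcp' : c ≤ p (σ i) := by nlinarith [hcp (σ i)]
  nlinarith [mul_le_mul_of_nonneg_right hcp' (dissipation_slack_nonneg (A i j) (y i) (y j))]

lemma deriv_abs_eq_sign_mul {f : ℝ → ℝ} {d t : ℝ} (hf : HasDerivAt f d t) :
    deriv (fun s => |f s|) t = Real.sign (f t) * d := by
  rcases lt_trichotomy (f t) 0 with h | h | h
  · have : (fun s => |f s|) =ᶠ[𝓝 t] fun s => -f s :=
      (hf.continuousAt.eventually_lt_const h).mono fun s hs => abs_of_neg hs
    rw [this.deriv_eq, hf.fun_neg.deriv, Real.sign_of_neg h, neg_one_mul]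
  · rw [h, Real.sign_zero, zero_mul]
    exact IsLocalMin.deriv_eq_zero (Eventually.of_forall fun s => by simp [h])
  · have : (fun s => |f s|) =ᶠ[𝓝 t] f :=
      (hf.continuousAt.eventually_const_lt h).mono fun s hs => abs_of_pos hs
    rw [this.deriv_eq, hf.deriv, Real.sign_of_pos h, one_mul]

lemma deriv_sortedPotential {N : ℕ} {p : Fin N → ℝ} (hp : Antitone p) {y : ℝ → Fin N → ℝ} {t : ℝ}
    (hy : ∀ i, DifferentiableAt ℝ (fun s => y s i) t)
    (hV : DifferentiableAt ℝ (fun s => sortedPotential p (y s)) t)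
    {σ : Equiv.Perm (Fin N)} (hσ : ∀ i j, σ i ≤ σ j → y t j ≤ y t i) :
    deriv (fun s => sortedPotential p (y s)) t = ∑ i, p (σ i) * deriv (fun s => y s i) t := by
  have hf : HasDerivAt (fun s => ∑ i, p (σ i) * y s i)
      (∑ i, p (σ i) * deriv (fun s => y s i) t) t :=
    HasDerivAt.fun_sum fun i _ => (hy i).hasDerivAt.const_mul _
  have hmin : IsLocalMin (fun s => sortedPotential p (y s) - ∑ i, p (σ i) * y s i) t :=
    Eventually.of_forall fun s => by
      simpa [sortedPotential_eq hp hσ] using le_sortedPotential p (y s) σ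
  exact sub_eq_zero.1 (hmin.hasDerivAt_eq_zero (hV.hasDerivAt.sub hf))

section Trajectories

variable {N : ℕ} {A : ℝ → Matrix (Fin N) (Fin N) ℝ} {x : ℝ → Fin N → ℝ}

lemma IsSolution.eq_add_integral_flux (hA : IsAdjacency A) (hx : IsSolution A x) {t : ℝ}
    (ht : 0 ≤ t) (i : Fin N) : x t i = x 0 i + ∫ s in (0:ℝ)..t, ∑ j, flux (A s) (x s) i j := by
  simpa only [neg_sLap_mulVec (hA.2.2 _)] using hx.2 t ht i

lemma IsSolution.continuousOn_apply (hx : IsSolution A x) (i : Fin N) :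
    ContinuousOn (fun t => x t i) (Set.Ici 0) :=
  (continuous_apply i).comp_continuousOn hx.1

lemma IsSolution.aemeasurable_apply (hx : IsSolution A x) (i : Fin N) :
    AEMeasurable (fun t => x t i) (volume.restrict (Set.Ici 0)) :=
  (hx.continuousOn_apply i).aemeasurable measurableSet_Ici

lemma IsSolution.aemeasurable_flux (hA : IsAdjacency A) (hx : IsSolution A x) (i j : Fin N) :
    AEMeasurable (fun t => flux (A t) (x t) i j) (volume.restrict (Set.Ici 0)) := by
  have ha : AEMeasurable (fun t => A t i j) (volume.restrict (Set.Ici 0)) :=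
    (hA.1 i j).aemeasurable
  exact (ha.mul (hx.aemeasurable_apply j)).sub (ha.abs.mul (hx.aemeasurable_apply i))

lemma measurable_realSign : Measurable Real.sign := by
  unfold Real.sign
  exact Measurable.ite measurableSet_Iio measurable_const
    (Measurable.ite measurableSet_Ioi measurable_const measurable_const)

lemma IsSolution.aemeasurable_dissipation (hA : IsAdjacency A) (hx : IsSolution A x) :
    AEMeasurable (fun t => dissipation (A t) (x t)) (volume.restrict (Set.Ici 0)) := by
  refine Finset.aemeasurable_fun_sum _ fun i _ => Finset.aemeasurable_fun_sum _ fun j _ => ?_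
  have ha : AEMeasurable (fun t => A t i j) (volume.restrict (Set.Ici 0)) :=
    (hA.1 i j).aemeasurable
  have hi := hx.aemeasurable_apply i
  have hj := hx.aemeasurable_apply j
  exact (ha.abs.mul (hj.abs.sub hi.abs).abs).add ((ha.abs.mul hj.abs).sub
    ((measurable_realSign.comp_aemeasurable hi).mul (ha.mul hj)))

lemma IsSolution.exists_flux_bound (hA : IsAdjacency A) (hx : IsSolution A x) (T : ℝ) :
    ∃ C, 0 ≤ C ∧ ∀ t ∈ Set.Icc 0 T, ∀ i, |∑ j, flux (A t) (x t) i j| ≤ C := by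
  obtain ⟨C, hC⟩ := hA.2.1 T
  obtain ⟨M, hM⟩ := isCompact_Icc.exists_bound_of_continuousOn
    (hx.1.mono (Set.Icc_subset_Ici_self : Set.Icc 0 T ⊆ Set.Ici 0))
  have hflux : ∀ t ∈ Set.Icc 0 T, ∀ i j, |flux (A t) (x t) i j| ≤ |C| * |M| + |C| * |M| := by
    intro t ht i j
    have hxM : ∀ i, |x t i| ≤ |M| := fun i =>
      (norm_le_pi_norm (x t) i).trans ((hM t ht).trans (le_abs_self M))
    have hAC := (hC t ht i j).trans (le_abs_self C)
    refine (abs_sub _ _).trans ?_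
    rw [abs_mul, abs_mul, abs_abs]
    exact add_le_add (mul_le_mul hAC (hxM j) (abs_nonneg _) (abs_nonneg _))
      (mul_le_mul hAC (hxM i) (abs_nonneg _) (abs_nonneg _))
  refine ⟨∑ _j : Fin N, (|C| * |M| + |C| * |M|), by positivity, fun t ht i => ?_⟩
  exact (Finset.abs_sum_le_sum_abs _ _).trans (Finset.sum_le_sum fun j _ => hflux t ht i j)

lemma IsSolution.intervalIntegrable_velocity (hA : IsAdjacency A) (hx : IsSolution A x)
    {s t : ℝ} (hs : 0 ≤ s) (ht : 0 ≤ t) (i : Fin N) :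
    IntervalIntegrable (fun t => ∑ j, flux (A t) (x t) i j) volume s t := by
  obtain ⟨C, -, hC⟩ := hx.exists_flux_bound hA (max s t)
  rw [intervalIntegrable_iff]
  have hsub : Set.uIoc s t ⊆ Set.Icc 0 (max s t) := fun r hr =>
    ⟨(le_min hs ht).trans hr.1.le, hr.2⟩
  refine IntegrableOn.of_bound (by simp [Set.uIoc]) ?_ C ?_
  · exact ((Finset.aemeasurable_fun_sum _ fun j _ => hx.aemeasurable_flux hA i j).mono_measure
      (Measure.restrict_mono (hsub.trans Set.Icc_subset_Ici_self) le_rfl)).aestronglyMeasurable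
  · exact (ae_restrict_mem measurableSet_uIoc).mono fun r hr => hC r (hsub hr) i

lemma IsSolution.exists_lipschitz (hA : IsAdjacency A) (hx : IsSolution A x) (T : ℝ) :
    ∃ C, 0 ≤ C ∧ ∀ s ∈ Set.Icc 0 T, ∀ t ∈ Set.Icc 0 T, ∀ i, |x t i - x s i| ≤ C * |t - s| := by
  obtain ⟨C, hC0, hC⟩ := hx.exists_flux_bound hA T
  refine ⟨C, hC0, fun s hs t ht i => ?_⟩
  rw [hx.eq_add_integral_flux hA hs.1, hx.eq_add_integral_flux hA ht.1, add_sub_add_left_eq_sub,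
    intervalIntegral.integral_interval_sub_left
      (hx.intervalIntegrable_velocity hA le_rfl ht.1 i)
      (hx.intervalIntegrable_velocity hA le_rfl hs.1 i)]
  refine intervalIntegral.norm_integral_le_of_norm_le_const
    (f := fun s => ∑ j, flux (A s) (x s) i j) fun r hr =>
      hC r ⟨(le_min hs.1 ht.1).trans hr.1.le, hr.2.trans (max_le hs.2 ht.2)⟩ i

lemma IsSolution.ae_hasDerivAt (hA : IsAdjacency A) (hx : IsSolution A x) :
    ∀ᵐ t, 0 < t → ∀ i, HasDerivAt (fun t => x t i) (∑ j, flux (A t) (x t) i j) t := by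
  have h : ∀ (n : ℕ) (i : Fin N), ∀ᵐ t, t ∈ Set.uIcc (0:ℝ) n → ∀ c ∈ Set.uIcc (0:ℝ) n,
      HasDerivAt (fun u => ∫ s in c..u, ∑ j, flux (A s) (x s) i j)
        (∑ j, flux (A t) (x t) i j) t := fun n i =>
    (hx.intervalIntegrable_velocity hA le_rfl n.cast_nonneg i).ae_hasDerivAt_integral
  filter_upwards [ae_all_iff.2 fun n => ae_all_iff.2 (h n)] with t ht ht0 i
  obtain ⟨n, hn⟩ := exists_nat_ge t
  have := (ht n i (Set.mem_uIcc_of_le ht0.le hn) 0 Set.left_mem_uIcc).const_add (x 0 i)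
  refine this.congr_of_eventuallyEq ?_
  filter_upwards [eventually_gt_nhds ht0] with s hs
  exact hx.eq_add_integral_flux hA hs.le i

lemma absolutelyContinuous_of_abs_sub_le {f : ℝ → ℝ} {C T : ℝ} (hT : 0 ≤ T) (hC : 0 ≤ C)
    (h : ∀ s ∈ Set.Icc 0 T, ∀ t ∈ Set.Icc 0 T, |f t - f s| ≤ C * |t - s|) :
    AbsolutelyContinuousOnInterval f 0 T := by
  refine LipschitzOnWith.absolutelyContinuousOnInterval (K := C.toNNReal)
    (LipschitzOnWith.of_dist_le_mul fun s hs t ht => ?_)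
  rw [Set.uIcc_of_le hT] at hs ht
  simpa [Real.dist_eq, hC] using h t ht s hs

lemma IsSolution.integrableOn_dissipation (hA : IsAdjacency A) (hCB : CutBalanced A)
    (hx : IsSolution A x) : IntegrableOn (fun t => dissipation (A t) (x t)) (Set.Ici 0) := by
  obtain ⟨K, hK, hcut⟩ := hCB
  let r : ℝ := 1 / (2 * K)
  have hr0 : 0 < r := by positivity
  have hr1 : r ≤ 1 := by
    rw [div_le_one (by positivity)]; linarith
  have hrK : r * (2 * K) = 1 := by simp only [r]; field_simp
  let p : Fin N → ℝ := fun i => r ^ (i : ℕ)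
  let c : ℝ := r ^ N / (2 * (1 + K))
  have hc0 : 0 < c := by positivity
  have hp0 : ∀ i, 0 ≤ p i := fun i => by positivity
  have hp : Antitone p := fun i j hij => pow_le_pow_of_le_one hr0.le hr1 hij
  have hp2 : ∀ m n, m < n → p n * (2 * K) ≤ p m := fun m n hmn => by
    calc p n * (2 * K) ≤ r ^ ((m : ℕ) + 1) * (2 * K) := by
          gcongr
          exact pow_le_pow_of_le_one hr0.le hr1 hmn
      _ = p m := by rw [pow_succ, mul_assoc, hrK, mul_one]
  have hcp : ∀ m, c * (2 * (1 + K)) ≤ p m := fun m => by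
    rw [div_mul_cancel₀ _ (by positivity)]
    exact pow_le_pow_of_le_one hr0.le hr1 m.2.le
  let χ : ℝ → Fin N → ℝ := fun t i => |x t i|
  let V : ℝ → ℝ := fun t => sortedPotential p (χ t)
  have hV0 : ∀ t, 0 ≤ V t := fun t => sortedPotential_nonneg hp0 fun i => abs_nonneg _
  have hχLip : ∀ T, ∃ C, 0 ≤ C ∧ ∀ s ∈ Set.Icc 0 T, ∀ t ∈ Set.Icc 0 T, ∀ i,
      |χ t i - χ s i| ≤ C * |t - s| := fun T => by
    obtain ⟨C, hC0, hC⟩ := hx.exists_lipschitz hA T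
    exact ⟨C, hC0, fun s hs t ht i => (abs_abs_sub_abs_le _ _).trans (hC s hs t ht i)⟩
  have hVac : ∀ T, 0 ≤ T → AbsolutelyContinuousOnInterval V 0 T := fun T hT => by
    obtain ⟨C, hC0, hC⟩ := hχLip T
    refine absolutelyContinuous_of_abs_sub_le (C := (∑ i, p i) * C) hT
      (mul_nonneg (Finset.sum_nonneg fun i _ => hp0 i) hC0) fun s hs t ht => ?_
    have h1 := sortedPotential_le_add hp0 (hC s hs t ht)
    have h2 := sortedPotential_le_add hp0 (hC t ht s hs)
    rw [abs_sub_comm s t] at h2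
    rw [mul_assoc, abs_le]
    constructor <;> linarith
  have hχac : ∀ i T, 0 ≤ T → AbsolutelyContinuousOnInterval (fun t => χ t i) 0 T :=
    fun i T hT => by
      obtain ⟨C, hC0, hC⟩ := hχLip T
      exact absolutelyContinuous_of_abs_sub_le hT hC0 fun s hs t ht => hC s hs t ht i
  have hcut' := (ae_restrict_iff' measurableSet_Ici).1 hcut
  have hrate : ∀ T, 0 ≤ T → ∀ᵐ t, t ∈ Set.Ioc 0 T →
      c * dissipation (A t) (x t) ≤ -deriv V t := fun T hT => by
    filter_upwards [hcut', hx.ae_hasDerivAt hA, (hVac T hT).ae_differentiableAt,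
      ae_all_iff.2 fun i => (hχac i T hT).ae_differentiableAt] with t hcutt hxt hVt hχt ht
    have htT : t ∈ Set.uIcc 0 T := Set.mem_uIcc_of_le ht.1.le ht.2
    obtain ⟨σ, hσ⟩ := exists_sorting_perm (χ t)
    rw [deriv_sortedPotential hp (fun i => hχt i htT) (hVt htT) hσ]
    simp only [χ, deriv_abs_eq_sign_mul (hxt ht.1 _)]
    refine mul_dissipation_le hK (fun W hW hW' => ?_) hc0.le hcp hp hp2 (x t) σ hσ
    have := (hcutt ht.1.le W hW hW').1
    rwa [inv_mul_le_iff₀ (by positivity)] at this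
  have hint : ∀ T, 0 ≤ T → IntegrableOn (fun t => dissipation (A t) (x t)) (Set.Ioc 0 T) :=
    fun T hT => by
      have hdV : IntegrableOn (fun t => c⁻¹ * -deriv V t) (Set.Ioc 0 T) :=
        (((intervalIntegrable_iff_integrableOn_Ioc_of_le hT).1
          (hVac T hT).intervalIntegrable_deriv).neg).const_mul _
      refine hdV.mono' ((hx.aemeasurable_dissipation hA).mono_measure
        (Measure.restrict_mono (Set.Ioc_subset_Icc_self.trans Set.Icc_subset_Ici_self)
          le_rfl)).aestronglyMeasurable ?_
      refine (ae_restrict_iff' measurableSet_Ioc).2 ((hrate T hT).mono fun t h ht => ?_)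
      rw [Real.norm_of_nonneg (dissipation_nonneg _ _), le_inv_mul_iff₀ hc0]
      exact h ht
  rw [integrableOn_Ici_iff_integrableOn_Ioi]
  refine integrableOn_Ioi_of_intervalIntegral_norm_bounded (c⁻¹ * V 0) 0
    (fun n : ℕ => hint n n.cast_nonneg) tendsto_natCast_atTop_atTop
    (Eventually.of_forall fun n => ?_)
  have hT : (0:ℝ) ≤ n := n.cast_nonneg
  have hdV := (hVac n hT).intervalIntegrable_deriv
  calc ∫ t in (0:ℝ)..n, ‖dissipation (A t) (x t)‖
      ≤ ∫ t in (0:ℝ)..n, c⁻¹ * -deriv V t := by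
        refine intervalIntegral.integral_mono_ae_restrict hT
          ((intervalIntegrable_iff_integrableOn_Ioc_of_le hT).2 (hint n hT)).norm
          (hdV.neg.const_mul _) ?_
        rw [Measure.restrict_congr_set Ioc_ae_eq_Icc.symm]
        refine (ae_restrict_iff' measurableSet_Ioc).2 ((hrate n hT).mono fun t h ht => ?_)
        change ‖dissipation (A t) (x t)‖ ≤ c⁻¹ * -deriv V t
        rw [Real.norm_of_nonneg (dissipation_nonneg _ _), le_inv_mul_iff₀ hc0]
        exact h ht
    _ = c⁻¹ * (V 0 - V n) := by
        rw [intervalIntegral.integral_const_mul, intervalIntegral.integral_neg,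
          (hVac n hT).integral_deriv_eq_sub, neg_sub]
    _ ≤ c⁻¹ * V 0 := by
        gcongr
        linarith [hV0 n]

end Trajectories

lemma eq_zero_of_lintegral_eq_top {f g h : ℝ → ℝ} {L : ℝ}
    (hf : ∀ T : ℝ, ∃ C : ℝ, ∀ t ∈ Set.Icc (0:ℝ) T, f t ≤ C)
    (hh : IntegrableOn h (Set.Ici 0)) (hfg : ∀ t, f t * |g t| ≤ h t)
    (hf0 : ∀ t, 0 ≤ f t) (hg : Tendsto g atTop (𝓝 L))
    (htop : ∫⁻ t in Set.Ici (0:ℝ), ENNReal.ofReal (f t) = ⊤) : L = 0 := by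
  by_contra hL
  have hL' : 0 < |L| / 2 := by positivity
  obtain ⟨T, hT⟩ := eventually_atTop.1
    ((hg.abs.eventually_const_lt (half_lt_self (abs_pos.2 hL))).and (eventually_ge_atTop 0))
  obtain ⟨C, hC⟩ := hf T
  have h1 : ∫⁻ t in Set.Icc 0 T, ENNReal.ofReal (f t) < ⊤ := by
    refine (setLIntegral_mono measurable_const
      fun t ht => ENNReal.ofReal_le_ofReal (hC t ht)).trans_lt ?_
    simp [ENNReal.mul_lt_top]
  have h2 : ∫⁻ t in Set.Ici T, ENNReal.ofReal (f t) < ⊤ := by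
    have hhT : IntegrableOn (fun t => (|L| / 2)⁻¹ * h t) (Set.Ici T) :=
      (hh.mono_set (Set.Ici_subset_Ici.2 (hT T le_rfl).2)).const_mul _
    refine (setLIntegral_mono' measurableSet_Ici fun t ht =>
      ENNReal.ofReal_le_ofReal ?_).trans_lt hhT.lintegral_lt_top
    rw [le_inv_mul_iff₀ hL', mul_comm]
    exact (mul_le_mul_of_nonneg_left (hT t ht).1.le (hf0 t)).trans (hfg t)
  refine (lt_of_le_of_lt ?_ (ENNReal.add_lt_top.2 ⟨h1, h2⟩)).ne htop
  refine (lintegral_mono_set fun t ht => ?_).trans (lintegral_union_le _ _ _)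
  exact (le_total t T).imp (fun h => ⟨ht, h⟩) fun h => h

/-- for cut-balanced graphs, the functions `η_{ij} = |a_{ij}|(θ_{ij} χ_j − χ_i)`
and the derivatives `χ̇_i` are in `L¹[0,∞)`; every opinion has a finite limit `x_i⁰`; and
essential interaction forces `|x_i⁰| = |x_j⁰|`, essential cooperation `x_i⁰ = x_j⁰`, essential
competition `x_i⁰ = −x_j⁰`, and both together `x_i⁰ = x_j⁰ = 0`. -/
theorem stmt15 {N : ℕ} (hN : 2 ≤ N) (A : ℝ → Matrix (Fin N) (Fin N) ℝ)
    (hA : IsAdjacency A) (hCB : CutBalanced A)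
    (x : ℝ → Fin N → ℝ) (hx : IsSolution A x) :
    (∀ i j : Fin N, IntegrableOn
      (fun t => |A t i j| *
        ((Real.sign (A t i j) * Real.sign (x t i) * Real.sign (x t j)) * |x t j| - |x t i|))
      (Set.Ici (0:ℝ))) ∧
    (∀ i : Fin N, IntegrableOn (deriv fun t => |x t i|) (Set.Ici (0:ℝ))) ∧
    ∃ x0 : Fin N → ℝ,
      (∀ i, Tendsto (fun t => x t i) atTop (𝓝 (x0 i))) ∧
      ∀ i j : Fin N,
        (EssArc A i j → |x0 i| = |x0 j|) ∧
        (EssPlus A i j → x0 i = x0 j) ∧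
        (EssMinus A i j → x0 i = -x0 j) ∧
        (EssPlus A i j → EssMinus A i j → x0 i = 0 ∧ x0 j = 0) := by
  have hH := hx.integrableOn_dissipation hA hCB
  have hderiv := hx.ae_hasDerivAt hA
  have hsignflux : ∀ i j, IntegrableOn (fun t => Real.sign (x t i) * flux (A t) (x t) i j)
      (Set.Ici (0:ℝ)) := fun i j =>
    hH.mono' ((measurable_realSign.comp_aemeasurable (hx.aemeasurable_apply i)).mul
      (hx.aemeasurable_flux hA i j)).aestronglyMeasurable
      (Eventually.of_forall fun t => abs_sign_mul_flux_le _ _ _ _)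
  have hflux : ∀ i j, IntegrableOn (fun t => flux (A t) (x t) i j) (Set.Ici (0:ℝ)) := fun i j =>
    hH.mono' (hx.aemeasurable_flux hA i j).aestronglyMeasurable
      (Eventually.of_forall fun t => abs_flux_le _ _ _ _)
  refine ⟨fun i j => ?_, fun i => ?_, ?_⟩
  · simpa only [abs_mul_sign_eq, flux] using hsignflux i j
  · rw [integrableOn_Ici_iff_integrableOn_Ioi]
    have hsum : IntegrableOn (fun t => ∑ j, Real.sign (x t i) * flux (A t) (x t) i j)
        (Set.Ioi (0:ℝ)) :=
      integrable_finsetSum _ fun j _ => (hsignflux i j).mono_set Set.Ioi_subset_Ici_self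
    refine hsum.congr ((ae_restrict_iff' measurableSet_Ioi).2 (hderiv.mono fun t h ht => ?_))
    simp only [deriv_abs_eq_sign_mul (h ht i), Finset.mul_sum]
  · refine ⟨fun i => x 0 i + ∫ t in Set.Ioi (0:ℝ), ∑ j, flux (A t) (x t) i j, ?_⟩
    generalize hx0 : (fun i => x 0 i + ∫ t in Set.Ioi (0:ℝ), ∑ j, flux (A t) (x t) i j) = x0
    have hlim : ∀ i, Tendsto (fun t => x t i) atTop (𝓝 (x0 i)) := fun i => by
      have hsum : IntegrableOn (fun t => ∑ j, flux (A t) (x t) i j) (Set.Ioi (0:ℝ)) :=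
        integrable_finsetSum _ fun j _ => (hflux i j).mono_set Set.Ioi_subset_Ici_self
      rw [← hx0]
      refine ((intervalIntegral_tendsto_integral_Ioi 0 hsum tendsto_id).const_add _).congr' ?_
      filter_upwards [eventually_ge_atTop 0] with t ht
      exact (hx.eq_add_integral_flux hA ht i).symm
    have hplus : ∀ i j, EssPlus A i j → x0 i = x0 j := fun i j h => by
      refine sub_eq_zero.1 (eq_zero_of_lintegral_eq_top (f := fun t => max (A t i j) 0)
        (fun T => ?_) hH (fun t => ?_) (fun t => le_max_right _ _) ((hlim i).sub (hlim j)) h)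
      · obtain ⟨C, hC⟩ := hA.2.1 T
        exact ⟨C, fun t ht => max_le ((le_abs_self _).trans (hC t ht i j))
          ((abs_nonneg _).trans (hC t ht i j))⟩
      · rcases le_total (A t i j) 0 with ha | ha
        · simpa [ha] using dissipation_nonneg _ _
        · have := abs_flux_le (A t) (x t) i j
          rwa [flux, abs_of_nonneg ha, ← mul_sub, abs_mul, abs_of_nonneg ha, abs_sub_comm,
            ← max_eq_left ha] at this
    have hminus : ∀ i j, EssMinus A i j → x0 i = -x0 j := fun i j h => by
      refine eq_neg_iff_add_eq_zero.2 (eq_zero_of_lintegral_eq_top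
        (f := fun t => max (-(A t i j)) 0)
        (fun T => ?_) hH (fun t => ?_) (fun t => le_max_right _ _) ((hlim i).add (hlim j)) h)
      · obtain ⟨C, hC⟩ := hA.2.1 T
        exact ⟨C, fun t ht => max_le ((neg_le_abs _).trans (hC t ht i j))
          ((abs_nonneg _).trans (hC t ht i j))⟩
      · rcases le_total (A t i j) 0 with ha | ha
        · have := abs_flux_le (A t) (x t) i j
          rw [flux, abs_of_nonpos ha, neg_mul, sub_neg_eq_add, ← mul_add, abs_mul,
            abs_of_nonpos ha, add_comm] at this
          rwa [max_eq_left (neg_nonneg.2 ha)]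
        · simpa [ha] using dissipation_nonneg _ _
    refine ⟨hlim, fun i j => ⟨fun h => ?_, hplus i j, hminus i j, fun hp hm => ?_⟩⟩
    · refine sub_eq_zero.1 (eq_zero_of_lintegral_eq_top (f := fun t => |A t i j|)
        (fun T => ?_) hH (fun t => mul_abs_sub_le_dissipation _ _ _ _) (fun t => abs_nonneg _)
        ((hlim i).abs.sub (hlim j).abs) h)
      obtain ⟨C, hC⟩ := hA.2.1 T
      exact ⟨C, fun t ht => hC t ht i j⟩
    · have h1 := hplus i j hp
      have h2 := hminus i j hm
      constructor <;> linarith
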